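/- arXiv:2509.00408 — 2 statements merged into one kernel-verified Lean document; each statement's English description precedes it below -/
import Mathlib

section
/- Let X be a real-valued integrable random variable on a probability space, 0 < α < 1/2, and let e ∈ ℝ satisfy α·E[(X − e)⁺] = (1 − α)·E[(X − e)⁻]. Let x₀ ∈ ℝ be arbitrary and define x_{i+1} = ψ_α(x_i) for i = 0, 1, 2, …, where ψ_α(x) = (α·E[X·1_{X>x}] + (1 − α)·E[X·1_{X≤x}]) / (α·P(X > x) + (1 − α)·P(X ≤ x)). Then e ≤ x_i for all i ≥ 1 and x_{i+1} ≤ x_i for all i ≥ 1; i.e., the sequence is decreasing and bounded below by e with the possible exception of x₀. -/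
open MeasureTheory
open scoped ProbabilityTheory

/-- The two-sided fixed point map
`ψ_α(x) = (α·E[X·1_{X>x}] + (1−α)·E[X·1_{X≤x}]) / (α·P(X>x) + (1−α)·P(X≤x))`. -/
noncomputable def psi {Ω : Type*} [MeasureSpace Ω] (X : Ω → ℝ) (α : ℝ) (x : ℝ) : ℝ :=
  (α * (∫ ω in {ω | x < X ω}, X ω) + (1 - α) * ∫ ω in {ω | X ω ≤ x}, X ω) /
    (α * (ℙ {ω | x < X ω}).toReal + (1 - α) * (ℙ {ω | X ω ≤ x}).toReal)

/-- The weighted denominator in `psi` is positive, and `(psi X α x - c)` times it is the integral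
of `X - c` weighted by `α` above `x` and by `1 - α` below. -/
theorem exists_pos_psi_sub_mul_eq_integral {Ω : Type*} [MeasureSpace Ω]
    [IsProbabilityMeasure (ℙ : Measure Ω)] {X : Ω → ℝ} (hX : Integrable X) {α : ℝ}
    (hα0 : 0 < α) (hα1 : α < 1) (x c : ℝ) :
    ∃ d : ℝ, 0 < d ∧ Integrable (fun ω => (if X ω ≤ x then 1 - α else α) * (X ω - c)) ∧
      (psi X α x - c) * d = ∫ ω, (if X ω ≤ x then 1 - α else α) * (X ω - c) := by
  have hA : NullMeasurableSet {ω | X ω ≤ x} (ℙ : Measure Ω) :=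
    nullMeasurableSet_le hX.aemeasurable aemeasurable_const
  have hB : NullMeasurableSet {ω | x < X ω} (ℙ : Measure Ω) :=
    nullMeasurableSet_lt aemeasurable_const hX.aemeasurable
  have hAB : {ω | x < X ω} = {ω | X ω ≤ x}ᶜ := by ext; simp
  have hXc : Integrable (fun ω => X ω - c) := hX.sub (integrable_const c)
  have hsum : (ℙ {ω | X ω ≤ x}).toReal + (ℙ {ω | x < X ω}).toReal = 1 := by
    rw [hAB]
    exact (measureReal_add_measureReal_compl₀ hA).trans probReal_univ
  have hweight : (fun ω => (if X ω ≤ x then 1 - α else α) * (X ω - c)) = fun ω =>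
      α * {ω | x < X ω}.indicator (fun ω => X ω - c) ω +
        (1 - α) * {ω | X ω ≤ x}.indicator (fun ω => X ω - c) ω := by
    ext ω
    by_cases h : X ω ≤ x
    · simp [h]
    · simp [h, not_le.mp h]
  have hiB := (hXc.indicator₀ hB).const_mul α
  have hiA := (hXc.indicator₀ hA).const_mul (1 - α)
  have hd : 0 < α * (ℙ {ω | x < X ω}).toReal + (1 - α) * (ℙ {ω | X ω ≤ x}).toReal := by
    have hp : 0 ≤ (ℙ {ω | X ω ≤ x}).toReal := ENNReal.toReal_nonneg
    have hq : 0 ≤ (ℙ {ω | x < X ω}).toReal := ENNReal.toReal_nonneg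
    rcases hp.eq_or_lt with h | h
    · rw [← h] at hsum ⊢
      nlinarith
    · nlinarith [mul_nonneg hα0.le hq, mul_pos (sub_pos.2 hα1) h]
  refine ⟨_, hd, hweight ▸ hiB.add hiA, ?_⟩
  rw [hweight, integral_add hiB hiA, integral_const_mul, integral_const_mul,
    integral_indicator₀ hB, integral_indicator₀ hA,
    integral_sub hX.integrableOn (integrable_const c),
    integral_sub hX.integrableOn (integrable_const c), sub_mul, psi, div_mul_cancel₀ _ hd.ne']
  simp only [setIntegral_const, smul_eq_mul, Measure.real]
  ring

/-- For `0 < α < 1/2`, `e` the `α`-expectile, and any sequence generated by the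
fixed point iteration `x_{i+1} = ψ_α(x_i)`: the sequence is bounded below by `e`
and decreasing, with the possible exception of `x₀`. -/
theorem stmt_8 {Ω : Type*} [MeasureSpace Ω] [IsProbabilityMeasure (ℙ : Measure Ω)]
    (X : Ω → ℝ) (hX : Integrable X) (α : ℝ) (hα0 : 0 < α) (hα1 : α < 1 / 2) (e : ℝ)
    (he : α * (∫ ω, max (X ω - e) 0) = (1 - α) * ∫ ω, max (e - X ω) 0)
    (x : ℕ → ℝ) (hx : ∀ i : ℕ, x (i + 1) = psi X α (x i)) :
    (∀ i : ℕ, 1 ≤ i → e ≤ x i) ∧ (∀ i : ℕ, 1 ≤ i → x (i + 1) ≤ x i) := by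
  have hpos : Integrable (fun ω => α * max (X ω - e) 0) :=
    (hX.sub (integrable_const e)).pos_part.const_mul α
  have hneg : Integrable (fun ω => (1 - α) * max (e - X ω) 0) :=
    ((integrable_const e).sub hX).pos_part.const_mul (1 - α)
  have hzero : ∫ ω, (α * max (X ω - e) 0 - (1 - α) * max (e - X ω) 0) = 0 := by
    rw [integral_sub hpos hneg, integral_const_mul, integral_const_mul, he, sub_self]
  have hlower : ∀ y, e ≤ psi X α y := by
    intro y
    obtain ⟨d, hd, hint, heq⟩ :=
      exists_pos_psi_sub_mul_eq_integral hX hα0 (by linarith : α < 1) y e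
    have h := integral_mono (hpos.sub hneg) hint fun ω => by
      simp only [Pi.sub_apply]
      rcases le_total (X ω) e with h | h
      · rw [max_eq_right (by linarith), max_eq_left (by linarith)]
        split_ifs <;> nlinarith
      · rw [max_eq_left (by linarith), max_eq_right (by linarith)]
        split_ifs <;> nlinarith
    simp only [Pi.sub_apply] at h
    rw [hzero, ← heq] at h
    exact sub_nonneg.1 (nonneg_of_mul_nonneg_left h hd)
  have hupper : ∀ y, e ≤ y → psi X α y ≤ y := by
    intro y hy
    obtain ⟨d, hd, hint, heq⟩ :=
      exists_pos_psi_sub_mul_eq_integral hX hα0 (by linarith : α < 1) y y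
    have h := integral_mono hint (hpos.sub hneg) fun ω => by
      simp only [Pi.sub_apply]
      rcases le_total (X ω) e with h | h
      · rw [max_eq_right (by linarith), max_eq_left (by linarith), if_pos (h.trans hy)]
        nlinarith
      · rw [max_eq_left (by linarith), max_eq_right (by linarith)]
        split_ifs <;> nlinarith
    simp only [Pi.sub_apply] at h
    rw [hzero, ← heq] at h
    by_contra! hlt
    exact absurd h (not_le.2 (mul_pos (sub_pos.2 hlt) hd))
  have hbound : ∀ i : ℕ, 1 ≤ i → e ≤ x i := by
    rintro (_ | i) hi
    · omega
    · exact hx i ▸ hlower (x i)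
  exact ⟨hbound, fun i hi => hx i ▸ hupper (x i) (hbound i hi)⟩
end

section
/- Let z_1 ≤ z_2 ≤ … ≤ z_N be real numbers, z̄ = (1/N)·Σ_{n=1}^N z_n, 0 < α < 1/2, and let e be the unique fixed point of φ̂_α(x) = z̄ + ((2α − 1)/(N(1 − α)))·Σ_{n : z_n ≥ x} (z_n − x). Then x ≤ e implies φ̂_α(x) ≤ e, and x ≥ e implies φ̂_α(x) ≥ e. Consequently, the iterates x_{i+1} = φ̂_α(x_i) form a decreasing sequence bounded below by e if x₀ ≥ e, and an increasing sequence bounded above by e if x₀ ≤ e. -/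
open Finset

/-- The one-sided empirical fixed point map
`φ̂_α(x) = z̄ + ((2α − 1)/(N(1 − α)))·Σ_{n : z_n ≥ x} (z_n − x)`,
for a sample `z 0, …, z n` of size `N = n + 1` with mean `z̄`. -/
noncomputable def phiHat (n : ℕ) (z : Fin (n + 1) → ℝ) (α : ℝ) (x : ℝ) : ℝ :=
  (∑ i, z i) / (n + 1) +
    (2 * α - 1) / ((n + 1) * (1 - α)) * ∑ i ∈ univ.filter (fun i => x ≤ z i), (z i - x)

/-- The sum in `phiHat` written with positive parts. -/
theorem phiHat_eq_sum_max (n : ℕ) (z : Fin (n + 1) → ℝ) (α x : ℝ) :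
    phiHat n z α x = (∑ i, z i) / (n + 1) -
      (1 - 2 * α) / ((n + 1) * (1 - α)) * ∑ i, max (z i - x) 0 := by
  have h : ∑ i ∈ univ.filter (fun i => x ≤ z i), (z i - x) = ∑ i, max (z i - x) 0 := by
    rw [sum_filter]
    refine sum_congr rfl fun i _ => ?_
    split_ifs with hi
    · exact (max_eq_left (by linarith)).symm
    · exact (max_eq_right (by linarith)).symm
  rw [phiHat, h]
  ring

theorem monotone_phiHat (n : ℕ) (z : Fin (n + 1) → ℝ) {α : ℝ} (hα : α ≤ 1 / 2) :
    Monotone (phiHat n z α) := by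
  intro x y hxy
  have hc : 0 ≤ (1 - 2 * α) / ((n + 1) * (1 - α)) :=
    div_nonneg (by linarith) (mul_nonneg (by positivity) (by linarith))
  simp only [phiHat_eq_sum_max]
  gcongr

/-- `phiHat` is nonexpansive; only the upper bound on increments is stated here. -/
theorem phiHat_sub_le (n : ℕ) (z : Fin (n + 1) → ℝ) {α : ℝ} (hα0 : 0 ≤ α) (hα : α ≤ 1 / 2)
    {x y : ℝ} (hxy : x ≤ y) : phiHat n z α y - phiHat n z α x ≤ y - x := by
  have hc : 0 ≤ (1 - 2 * α) / ((n + 1) * (1 - α)) :=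
    div_nonneg (by linarith) (mul_nonneg (by positivity) (by linarith))
  have hc1 : (1 - 2 * α) / ((n + 1) * (1 - α)) * (n + 1) ≤ 1 := by
    have hn : (n : ℝ) + 1 ≠ 0 := by positivity
    have hα' : 0 < 1 - α := by linarith
    have h : (1 - 2 * α) / ((n + 1) * (1 - α)) * (n + 1) = (1 - 2 * α) / (1 - α) := by
      field_simp
    rw [h, div_le_one hα']
    linarith
  have hS : ∑ i, max (z i - x) 0 - ∑ i, max (z i - y) 0 ≤ (n + 1) * (y - x) := by
    rw [← sum_sub_distrib]
    refine (sum_le_card_nsmul univ _ (y - x) fun i _ => ?_).trans_eq (by simp)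
    have h1 := le_max_left (z i - y) 0
    have h2 := le_max_right (z i - y) 0
    have h : max (z i - x) 0 ≤ y - x + max (z i - y) 0 := max_le (by linarith) (by linarith)
    linarith
  simp only [phiHat_eq_sum_max]
  have h1 := mul_le_mul_of_nonneg_left hS hc
  have h2 := mul_le_mul_of_nonneg_right hc1 (sub_nonneg.2 hxy)
  linarith

/-- Let `e` be the unique fixed point of `φ̂_α` (`0 < α < 1/2`). Then
`x ≤ e` implies `φ̂_α(x) ≤ e` and `x ≥ e` implies `φ̂_α(x) ≥ e`; consequently,
the iterates `x_{i+1} = φ̂_α(x_i)` form a decreasing sequence bounded below by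
`e` if `x₀ ≥ e`, and an increasing sequence bounded above by `e` if `x₀ ≤ e`. -/
theorem stmt_15 (n : ℕ) (z : Fin (n + 1) → ℝ) (hz : Monotone z)
    (α : ℝ) (hα0 : 0 < α) (hα1 : α < 1 / 2) (e : ℝ)
    (he : phiHat n z α e = e) (huniq : ∀ e' : ℝ, phiHat n z α e' = e' → e' = e) :
    (∀ x : ℝ, x ≤ e → phiHat n z α x ≤ e) ∧
    (∀ x : ℝ, e ≤ x → e ≤ phiHat n z α x) ∧
    ∀ x : ℕ → ℝ, (∀ i : ℕ, x (i + 1) = phiHat n z α (x i)) →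
      (e ≤ x 0 → (∀ i : ℕ, e ≤ x i) ∧ ∀ i : ℕ, x (i + 1) ≤ x i) ∧
      (x 0 ≤ e → (∀ i : ℕ, x i ≤ e) ∧ ∀ i : ℕ, x i ≤ x (i + 1)) := by
  have hmono := monotone_phiHat n z hα1.le
  have hle : ∀ x, x ≤ e → phiHat n z α x ≤ e := fun x hx => (hmono hx).trans_eq he
  have hge : ∀ x, e ≤ x → e ≤ phiHat n z α x := fun x hx => he.symm.trans_le (hmono hx)
  refine ⟨hle, hge, fun x hx => ⟨fun h0 => ?_, fun h0 => ?_⟩⟩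
  · have hb : ∀ i, e ≤ x i := fun i => by
      induction i with
      | zero => exact h0
      | succ k ih => exact hx k ▸ hge _ ih
    refine ⟨hb, fun i => ?_⟩
    have h := phiHat_sub_le n z hα0.le hα1.le (hb i)
    rw [hx i]
    linarith
  · have hb : ∀ i, x i ≤ e := fun i => by
      induction i with
      | zero => exact h0
      | succ k ih => exact hx k ▸ hle _ ih
    refine ⟨hb, fun i => ?_⟩
    have h := phiHat_sub_le n z hα0.le hα1.le (hb i)
    rw [hx i]
    linarith
end
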